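/- arXiv:2410.09669 — 2 statements merged into one kernel-verified Lean document; each statement's English description precedes it below -/
import Mathlib

section
/- Let r¹, r², r³ : ℝ² → ℝ be smooth functions of (t,x) satisfying the diagonal system S: r¹_t + (r¹+r²+1) r¹_x = 0, r²_t + (r¹+r²−1) r²_x = 0, r³_t + (r¹+r²) r³_x = 0. Then the pair (ρ, σ) with ρ := e^{r¹−r²} and σ := e^{r¹−r²}(r¹+r²) is a conserved current of S, i.e., ∂_t(e^{r¹−r²}) + ∂_x(e^{r¹−r²}(r¹+r²)) = 0 identically; equivalently, the 1-form e^{r¹−r²}(dx − (r¹+r²)dt) defining the reciprocal transformation is closed on solutions of S. -/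
/-- Partial derivative with respect to the first variable `t`. -/
noncomputable def pt (f : ℝ → ℝ → ℝ) (t x : ℝ) : ℝ := deriv (fun s => f s x) t

/-- Partial derivative with respect to the second variable `x`. -/
noncomputable def px (f : ℝ → ℝ → ℝ) (t x : ℝ) : ℝ := deriv (fun s => f t s) x

/-- A function differentiable in both variables jointly has `pt` as its `t`-derivative. -/
theorem hasDerivAt_pt {f : ℝ → ℝ → ℝ} (hf : Differentiable ℝ (Function.uncurry f)) (t x : ℝ) :
    HasDerivAt (fun s => f s x) (pt f t x) t := by
  have h : Differentiable ℝ (fun s => Function.uncurry f (s, x)) := by fun_prop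
  exact (h t).hasDerivAt

/-- A function differentiable in both variables jointly has `px` as its `x`-derivative. -/
theorem hasDerivAt_px {f : ℝ → ℝ → ℝ} (hf : Differentiable ℝ (Function.uncurry f)) (t x : ℝ) :
    HasDerivAt (fun s => f t s) (px f t x) x := by
  have h : Differentiable ℝ (fun s => Function.uncurry f (t, s)) := by fun_prop
  exact (h x).hasDerivAt

/-- If smooth `r¹, r², r³` solve the diagonal system `S`, then the pair
`(ρ, σ) = (e^{r¹−r²}, e^{r¹−r²}(r¹+r²))` is a conserved current of `S`:
`∂_t(e^{r¹−r²}) + ∂_x(e^{r¹−r²}(r¹+r²)) = 0` identically, i.e., the 1-form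
`e^{r¹−r²}(dx − (r¹+r²)dt)` defining the reciprocal transformation is closed on
solutions of `S`. -/
theorem conserved_current_of_diagonal_system
    (r1 r2 r3 : ℝ → ℝ → ℝ)
    (hr1 : ContDiff ℝ (⊤ : ℕ∞) (Function.uncurry r1))
    (hr2 : ContDiff ℝ (⊤ : ℕ∞) (Function.uncurry r2))
    (hr3 : ContDiff ℝ (⊤ : ℕ∞) (Function.uncurry r3))
    (hS1 : ∀ t x, pt r1 t x + (r1 t x + r2 t x + 1) * px r1 t x = 0)
    (hS2 : ∀ t x, pt r2 t x + (r1 t x + r2 t x - 1) * px r2 t x = 0)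
    (hS3 : ∀ t x, pt r3 t x + (r1 t x + r2 t x) * px r3 t x = 0) :
    ∀ t x, pt (fun t x => Real.exp (r1 t x - r2 t x)) t x
      + px (fun t x => Real.exp (r1 t x - r2 t x) * (r1 t x + r2 t x)) t x = 0 := by
  intro t x
  have hd1 := hr1.differentiable (by simp)
  have hd2 := hr2.differentiable (by simp)
  have ht := ((hasDerivAt_pt hd1 t x).sub (hasDerivAt_pt hd2 t x)).exp.deriv
  have hx := (((hasDerivAt_px hd1 t x).sub (hasDerivAt_px hd2 t x)).exp.mul
    ((hasDerivAt_px hd1 t x).add (hasDerivAt_px hd2 t x))).deriv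
  calc
    _ = Real.exp (r1 t x - r2 t x) * (pt r1 t x - pt r2 t x)
        + (Real.exp (r1 t x - r2 t x) * (px r1 t x - px r2 t x) * (r1 t x + r2 t x)
          + Real.exp (r1 t x - r2 t x) * (px r1 t x + px r2 t x)) :=
      congrArg₂ (· + ·) ht hx
    _ = 0 := by
      linear_combination Real.exp (r1 t x - r2 t x) * (hS1 t x - hS2 t x)
end

section
/- Let ε₁, ε₂, ε₃ ∈ {−1, 1}, let Φ¹, Φ², Φ³ : ℝ → ℝ and Ω : ℝ → ℝ be smooth functions of z, and let Ψ¹, Ψ², Ψ³ : ℝ² → ℝ be smooth solutions of the Klein–Gordon equation Ψ^α_y − Ψ^α_x = 2 Ψ^α_{xy} such that ∑_{α=1}^3 ε_α (Φ^α(z) + ½ Ψ^α(x,y)) Ψ^α(x,y) = Ω(z) − e^{x−y} for all (x,y,z) ∈ ℝ³. Then ∑_{α=1}^3 ε_α Ψ^α_x(x,y) Ψ^α_y(x,y) = 0 for all (x,y) ∈ ℝ². -/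
/-- Partial derivative with respect to the first variable `x`. -/
noncomputable def pdx (f : ℝ → ℝ → ℝ) (x y : ℝ) : ℝ := deriv (fun s => f s y) x

/-- Partial derivative with respect to the second variable `y`. -/
noncomputable def pdy (f : ℝ → ℝ → ℝ) (x y : ℝ) : ℝ := deriv (fun s => f x s) y

theorem hasDerivAt_pdx {f : ℝ → ℝ → ℝ} (hf : Differentiable ℝ (Function.uncurry f)) (x y : ℝ) :
    HasDerivAt (fun s => f s y) (pdx f x y) x := by
  have h : Differentiable ℝ (fun s => Function.uncurry f (s, y)) :=
    hf.comp (differentiable_id.prodMk (differentiable_const y))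
  exact (h x).hasDerivAt

theorem hasDerivAt_pdy {f : ℝ → ℝ → ℝ} (hf : Differentiable ℝ (Function.uncurry f)) (x y : ℝ) :
    HasDerivAt (fun s => f x s) (pdy f x y) y := by
  have h : Differentiable ℝ (fun s => Function.uncurry f (x, s)) :=
    hf.comp ((differentiable_const x).prodMk differentiable_id)
  exact (h y).hasDerivAt

theorem differentiable_uncurry_pdy {f : ℝ → ℝ → ℝ} (hf : ContDiff ℝ 2 (Function.uncurry f)) :
    Differentiable ℝ (Function.uncurry (pdy f)) := by
  have hd : Differentiable ℝ (Function.uncurry f) := hf.differentiable (by norm_num)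
  have hpdy : Function.uncurry (pdy f) =
      fun p : ℝ × ℝ => fderiv ℝ (Function.uncurry f) p ((0 : ℝ), (1 : ℝ)) := by
    funext ⟨x, y⟩
    exact ((hd (x, y)).hasFDerivAt.comp_hasDerivAt y
      ((hasDerivAt_const y x).prodMk (hasDerivAt_id y))).deriv
  rw [hpdy]
  have h1 : Differentiable ℝ (fderiv ℝ (Function.uncurry f)) :=
    (hf.fderiv_right (m := 1) (by norm_num)).differentiable (by norm_num)
  exact h1.clm_apply (differentiable_const _)

/-- If `ε_α ∈ {−1,1}`, the `Φ^α` and `Ω` are smooth functions of `z`, the `Ψ^α` are smooth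
solutions of the Klein–Gordon equation `Ψ_y − Ψ_x = 2 Ψ_{xy}`, and
`∑ ε_α (Φ^α + ½Ψ^α) Ψ^α = Ω(z) − e^{x−y}` holds for all `(x,y,z)`, then
`∑ ε_α Ψ^α_x Ψ^α_y = 0` for all `(x,y)`. -/
theorem klein_gordon_differential_consequence
    (ε : Fin 3 → ℝ) (hε : ∀ α, ε α = 1 ∨ ε α = -1)
    (Φ : Fin 3 → ℝ → ℝ) (Ω : ℝ → ℝ) (Ψ : Fin 3 → ℝ → ℝ → ℝ)
    (hΦ : ∀ α, ContDiff ℝ (⊤ : ℕ∞) (Φ α))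
    (hΩ : ContDiff ℝ (⊤ : ℕ∞) Ω)
    (hΨ : ∀ α, ContDiff ℝ (⊤ : ℕ∞) (Function.uncurry (Ψ α)))
    (hKG : ∀ α, ∀ x y : ℝ,
      pdy (Ψ α) x y - pdx (Ψ α) x y = 2 * pdx (pdy (Ψ α)) x y)
    (h : ∀ x y z : ℝ,
      ∑ α : Fin 3, ε α * (Φ α z + Ψ α x y / 2) * Ψ α x y = Ω z - Real.exp (x - y)) :
    ∀ x y : ℝ, ∑ α : Fin 3, ε α * pdx (Ψ α) x y * pdy (Ψ α) x y = 0 := by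
  intro x y
  have hd α : Differentiable ℝ (Function.uncurry (Ψ α)) := (hΨ α).differentiable (by simp)
  have hd' α : Differentiable ℝ (Function.uncurry (pdy (Ψ α))) :=
    differentiable_uncurry_pdy ((hΨ α).of_le (WithTop.coe_le_coe.2 le_top))
  have hx : ∑ α, ε α * (Φ α 0 + Ψ α x y) * pdx (Ψ α) x y = -Real.exp (x - y) := by
    have h1 := HasDerivAt.fun_sum (u := Finset.univ) fun α _ =>
      ((((hasDerivAt_pdx (hd α) x y).div_const 2).const_add (Φ α 0)).const_mul (ε α)).mul
        (hasDerivAt_pdx (hd α) x y)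
    have h2 := (((hasDerivAt_id x).sub_const y).exp).const_sub (Ω 0)
    have h3 := h1.unique (h2.congr_of_eventuallyEq (.of_forall fun s => h s y 0))
    simp only [Fin.sum_univ_three, id] at h3 ⊢
    linear_combination h3
  have hy (s : ℝ) : ∑ α, ε α * (Φ α 0 + Ψ α s y) * pdy (Ψ α) s y = Real.exp (s - y) := by
    have h1 := HasDerivAt.fun_sum (u := Finset.univ) fun α _ =>
      ((((hasDerivAt_pdy (hd α) s y).div_const 2).const_add (Φ α 0)).const_mul (ε α)).mul
        (hasDerivAt_pdy (hd α) s y)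
    have h2 := (((hasDerivAt_id y).const_sub s).exp).const_sub (Ω 0)
    have h3 := h1.unique (h2.congr_of_eventuallyEq (.of_forall fun t => h s t 0))
    simp only [Fin.sum_univ_three, id] at h3 ⊢
    linear_combination h3
  have hxy : ∑ α, (ε α * pdx (Ψ α) x y * pdy (Ψ α) x y +
      ε α * (Φ α 0 + Ψ α x y) * pdx (pdy (Ψ α)) x y) = Real.exp (x - y) := by
    have h1 := HasDerivAt.fun_sum (u := Finset.univ) fun α _ =>
      (((hasDerivAt_pdx (hd α) x y).const_add (Φ α 0)).const_mul (ε α)).mul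
        (hasDerivAt_pdx (hd' α) x y)
    have h2 := ((hasDerivAt_id x).sub_const y).exp
    have h3 := h1.unique (h2.congr_of_eventuallyEq (.of_forall hy))
    simpa using h3
  have hyx := hy x
  simp only [Fin.sum_univ_three] at hx hyx hxy ⊢
  linear_combination hxy - hyx / 2 + hx / 2
    + ε 0 * (Φ 0 0 + Ψ 0 x y) / 2 * hKG 0 x y
    + ε 1 * (Φ 1 0 + Ψ 1 x y) / 2 * hKG 1 x y
    + ε 2 * (Φ 2 0 + Ψ 2 x y) / 2 * hKG 2 x y
end
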